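/- arXiv:2105.10009 — 6 statements merged into one kernel-verified Lean document; each statement's English description precedes it below -/
import Mathlib

section
/- Let μ ≥ 1 be a natural number, A an open subset of ℝ^α, U(x,y,a) a real-analytic function on [-1,1]² × A with U(0,0,a) > 0 for every a ∈ A and whose Taylor series at (x,y)=(0,0) is absolutely convergent on [-1,1]² for each a, and V(x,a) a real-analytic function on [-1,1] × A with V(x,a) > 0 for all (x,a) ∈ [-1,1] × A. For s > 0 small and ε near 0, let y(·; s,ε,a) be the solution on [s+ϑ_ε, 1] of the ODE y'(x) = -V(x,a) y(x) / (x(x^μ - ε)) with initial condition y(s+ϑ_ε) = 1, and define the Dulac time T(s;ε,a) := ∫_{s+ϑ_ε}^{1} U(x, y(x;s,ε,a), a)/(x^μ - ε) dx. Then ∂_s T(s;ε,a) → -∞ as (s,ε) → (0⁺, 0), uniformly with respect to a on every compact subset of A; that is, for every compact K ⊂ A and every M > 0 there exists δ > 0 such that ∂_s T(s;ε,a) < -M whenever 0 < s < δ, |ε| < δ and a ∈ K. -/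
open Set MeasureTheory

/-- `ϑ_ε`: the largest real root of `x (x^μ - ε)`, namely `0` if `ε ≤ 0` and
`ε^(1/μ)` if `ε ≥ 0`. -/
noncomputable def theta (μ : ℕ) (ε : ℝ) : ℝ := if ε ≤ 0 then 0 else ε ^ ((μ : ℝ)⁻¹)

/-- An analytic function is bounded on a compact set, and Lipschitz along the segments which are
contained in it, with a uniform constant. -/
theorem AnalyticOnNhd.exists_bound_lipschitz_segment {E : Type*} [NormedAddCommGroup E]
    [NormedSpace ℝ E] {f : E → ℝ} {Q : Set E} (hf : AnalyticOnNhd ℝ f Q) (hQ : IsCompact Q) :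
    ∃ C : ℝ, (∀ z ∈ Q, |f z| ≤ C) ∧
      ∀ z ∈ Q, ∀ w ∈ Q, segment ℝ z w ⊆ Q → |f z - f w| ≤ C * ‖z - w‖ := by
  obtain ⟨C₁, h₁⟩ := hQ.exists_bound_of_continuousOn hf.continuousOn
  have hc : ContinuousOn (fderiv ℝ f) Q := fun z hz =>
    (hf z hz).fderiv.continuousAt.continuousWithinAt
  obtain ⟨C₂, h₂⟩ := hQ.exists_bound_of_continuousOn hc
  refine ⟨max C₁ C₂, fun z hz => (h₁ z hz).trans (le_max_left _ _), fun z hz w hw hseg => ?_⟩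
  have := (convex_segment (𝕜 := ℝ) z w).norm_image_sub_le_of_norm_fderiv_le (f := f) (𝕜 := ℝ)
    (fun x hx => (hf x (hseg hx)).differentiableAt)
    (fun x hx => (h₂ x (hseg hx)).trans (le_max_right C₁ C₂))
    (right_mem_segment ℝ z w) (left_mem_segment ℝ z w)
  simpa using this

theorem theta_nonneg (μ : ℕ) (ε : ℝ) : 0 ≤ theta μ ε := by
  unfold theta
  split_ifs with h
  · exact le_rfl
  · exact Real.rpow_nonneg (not_le.1 h).le _

theorem lt_pow_of_theta_lt {μ : ℕ} (hμ : 1 ≤ μ) {ε x : ℝ} (hx : theta μ ε < x) : ε < x ^ μ := by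
  have h0 := (theta_nonneg μ ε).trans_lt hx
  unfold theta at hx
  split_ifs at hx with h
  · exact h.trans_lt (pow_pos h0 _)
  · have h' := not_le.1 h
    rw [← Real.rpow_inv_natCast_pow h'.le (n := μ) (by omega)]
    exact pow_lt_pow_left₀ hx (Real.rpow_nonneg h'.le _) (by omega)

theorem theta_lt_of_lt_pow {μ : ℕ} (hμ : 1 ≤ μ) {ε x : ℝ} (hx : 0 < x) (h : ε < x ^ μ) :
    theta μ ε < x := by
  unfold theta
  split_ifs with h0
  · exact hx
  · rw [Real.rpow_inv_lt_iff_of_pos (not_le.1 h0).le hx.le (by positivity)]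
    exact_mod_cast h

/-- Leibniz rule for an integral whose lower endpoint and integrand depend on the parameter. -/
theorem hasDerivAt_integral_param_left {h h' : ℝ → ℝ → ℝ} {c σ r : ℝ} (hr : 0 < r)
    (hrc : σ + r ≤ c)
    (hcont : ContinuousOn (Function.uncurry h) (Icc (σ - r) (σ + r) ×ˢ Icc (σ - r) c))
    (hcont' : ContinuousOn (Function.uncurry h') (Icc (σ - r) (σ + r) ×ˢ Icc (σ - r) c))
    (hder : ∀ p ∈ Ioo (σ - r) (σ + r), ∀ x ∈ Icc (σ - r) c,
      HasDerivAt (fun p => h p x) (h' p x) p) :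
    HasDerivAt (fun p => ∫ x in p..c, h p x) (-h σ σ + ∫ x in σ..c, h' σ x) σ := by
  have hslice : ∀ {g : ℝ → ℝ → ℝ},
      ContinuousOn (Function.uncurry g) (Icc (σ - r) (σ + r) ×ˢ Icc (σ - r) c) →
      ∀ p ∈ Icc (σ - r) (σ + r), ContinuousOn (g p) (Icc (σ - r) c) := fun hg p hp =>
    hg.comp (f := fun x => (p, x)) (by fun_prop) (fun x hx => ⟨hp, hx⟩)
  have hintegrable : ∀ {g : ℝ → ℝ → ℝ},
      ContinuousOn (Function.uncurry g) (Icc (σ - r) (σ + r) ×ˢ Icc (σ - r) c) →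
      ∀ p ∈ Icc (σ - r) (σ + r), ∀ x ∈ Icc (σ - r) c, ∀ x' ∈ Icc (σ - r) c,
      IntervalIntegrable (g p) volume x x' := fun hg p hp x hx x' hx' =>
    ((hslice hg p hp).mono (uIcc_subset_Icc hx hx')).intervalIntegrable
  have hIoo : Ioo (σ - r) (σ + r) ∈ nhds σ := Ioo_mem_nhds (by linarith) (by linarith)
  have hσ : σ ∈ Icc (σ - r) c := ⟨by linarith, by linarith⟩
  have hσ' : σ ∈ Icc (σ - r) (σ + r) := ⟨by linarith, by linarith⟩
  have hc : c ∈ Icc (σ - r) c := ⟨by linarith, by linarith⟩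
  have hsub : uIoc σ c ⊆ Icc (σ - r) c := uIoc_subset_uIcc.trans (uIcc_subset_Icc hσ hc)
  have hfix : HasDerivAt (fun p => ∫ x in σ..c, h p x) (∫ x in σ..c, h' σ x) σ := by
    obtain ⟨B, hB⟩ := (isCompact_Icc.prod isCompact_Icc).exists_bound_of_continuousOn hcont'
    refine (intervalIntegral.hasDerivAt_integral_of_dominated_loc_of_deriv_le
      (F := h) (F' := h') (bound := fun _ => B) hIoo ?_ (hintegrable hcont σ hσ' σ hσ c hc) ?_ ?_
      intervalIntegrable_const ?_).2
    · filter_upwards [hIoo] with p hp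
      exact (hintegrable hcont p (Ioo_subset_Icc_self hp) σ hσ c hc).def'.aestronglyMeasurable
    · exact (hintegrable hcont' σ hσ' σ hσ c hc).def'.aestronglyMeasurable
    · exact Filter.Eventually.of_forall fun x hx p hp =>
        hB (p, x) ⟨Ioo_subset_Icc_self hp, hsub hx⟩
    · exact Filter.Eventually.of_forall fun x hx p hp => hder p hp x (hsub hx)
  have hmov : HasDerivAt (fun p => ∫ x in p..σ, h p x) (-h σ σ) σ := by
    rw [hasDerivAt_iff_isLittleO, Asymptotics.isLittleO_iff]
    intro η hη
    have hat : ContinuousAt (Function.uncurry h) (σ, σ) :=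
      hcont.continuousAt (prod_mem_nhds (Icc_mem_nhds (by linarith) (by linarith))
        (Icc_mem_nhds (by linarith) (by linarith)))
    obtain ⟨ρ, hρ, hball⟩ := Metric.continuousAt_iff.1 hat η hη
    filter_upwards [hIoo, Metric.ball_mem_nhds σ hρ] with p hp hpρ
    have hpc : p ∈ Icc (σ - r) c := ⟨hp.1.le, by linarith [hp.2]⟩
    have key := intervalIntegral.norm_integral_le_of_norm_le_const (a := p) (b := σ)
      (f := fun x => h p x - h σ σ) (C := η) (fun x hx => by
        have hx' : |x - σ| ≤ |p - σ| := by
          have := abs_sub_right_of_mem_uIcc (uIoc_subset_uIcc hx)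
          rwa [abs_sub_comm, abs_sub_comm p]
        have hd : dist (p, x) (σ, σ) < ρ := by
          rw [Prod.dist_eq, max_lt_iff]
          exact ⟨hpρ, lt_of_le_of_lt hx' hpρ⟩
        exact (hball hd).le)
    rw [intervalIntegral.integral_sub (hintegrable hcont p (Ioo_subset_Icc_self hp) p hpc σ hσ)
      intervalIntegrable_const, intervalIntegral.integral_const] at key
    simp only [intervalIntegral.integral_same, smul_eq_mul, Real.norm_eq_abs] at key ⊢
    rw [abs_sub_comm σ p] at key
    convert key using 2
    ring
  refine (hmov.add hfix).congr_of_eventuallyEq ?_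
  filter_upwards [hIoo] with p hp
  have hpc : p ∈ Icc (σ - r) c := ⟨hp.1.le, by linarith [hp.2]⟩
  have hp' := Ioo_subset_Icc_self hp
  exact (intervalIntegral.integral_add_adjacent_intervals (hintegrable hcont p hp' p hpc σ hσ)
    (hintegrable hcont p hp' σ hσ c hc)).symm

/-- Differentiation of the Dulac time of the separable flow `x ↦ exp (F p - F x)`
with respect to the starting point. -/
theorem hasDerivAt_dulac_integral {S : Set (ℝ × ℝ)} (hSo : IsOpen S)
    (hS : Icc (0 : ℝ) 1 ×ˢ Icc (0 : ℝ) 1 ⊆ S) {u uy : ℝ × ℝ → ℝ} (hu : ContinuousOn u S)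
    (huy : ContinuousOn uy S)
    (hder : ∀ q ∈ S, HasDerivAt (fun y => u (q.1, y)) (uy q) q.2)
    {F k w : ℝ → ℝ} {θ σ : ℝ} (hθ : 0 ≤ θ) (hσ : θ < σ) (hσ1 : σ < 1)
    (hF : ∀ x ∈ Ioc θ 1, HasDerivAt F (k x) x) (hk : ContinuousOn k (Ioc θ 1))
    (hk0 : ∀ x ∈ Ioc θ 1, 0 ≤ k x) (hw : ContinuousOn w (Ioc θ 1)) :
    HasDerivAt (fun p => ∫ x in p..1, u (x, Real.exp (F p - F x)) * w x)
      (-(u (σ, 1) * w σ) + ∫ x in σ..1,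
        uy (x, Real.exp (F σ - F x)) * (Real.exp (F σ - F x) * k σ) * w x) σ := by
  have hFc : ContinuousOn F (Ioc θ 1) := fun x hx => (hF x hx).continuousAt.continuousWithinAt
  have hmono : MonotoneOn F (Ioc θ 1) := by
    refine monotoneOn_of_deriv_nonneg (convex_Ioc θ 1) hFc ?_ ?_
    · exact fun x hx => (hF x (interior_subset hx)).differentiableAt.differentiableWithinAt
    · intro x hx
      rw [(hF x (interior_subset hx)).deriv]
      exact hk0 x (interior_subset hx)
  obtain ⟨ρ, hρ, hthick⟩ :=
    (isCompact_Icc.prod isCompact_Icc).exists_cthickening_subset_open hSo hS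
  have hFσ : ContinuousAt F σ := (hF σ ⟨hσ, hσ1.le⟩).continuousAt
  have hG : ContinuousAt (fun q : ℝ × ℝ => Real.exp (F q.1 - F q.2)) (σ, σ) := by
    have h1 : ContinuousAt (fun q : ℝ × ℝ => F q.1) (σ, σ) :=
      ContinuousAt.comp (f := Prod.fst) (x := (σ, σ)) hFσ continuousAt_fst
    have h2 : ContinuousAt (fun q : ℝ × ℝ => F q.2) (σ, σ) :=
      ContinuousAt.comp (f := Prod.snd) (x := (σ, σ)) hFσ continuousAt_snd
    exact Real.continuous_exp.continuousAt.comp (h1.sub h2)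
  obtain ⟨r₀, hr₀, hball⟩ := Metric.continuousAt_iff.1 hG ρ hρ
  obtain ⟨r, hr, hrr₀, hrθ, hr1⟩ : ∃ r > 0, r < r₀ ∧ r < σ - θ ∧ r < 1 - σ := by
    refine ⟨min r₀ (min (σ - θ) (1 - σ)) / 2, ?_, ?_, ?_, ?_⟩
    · have : 0 < min r₀ (min (σ - θ) (1 - σ)) := by
        simp only [lt_min_iff]; exact ⟨hr₀, by linarith, by linarith⟩
      linarith
    all_goals
      have h0 : 0 < min r₀ (min (σ - θ) (1 - σ)) := by
        simp only [lt_min_iff]; exact ⟨hr₀, by linarith, by linarith⟩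
      have h1 := min_le_left r₀ (min (σ - θ) (1 - σ))
      have h2 := min_le_right r₀ (min (σ - θ) (1 - σ))
      have h3 := min_le_left (σ - θ) (1 - σ)
      have h4 := min_le_right (σ - θ) (1 - σ)
      linarith
  have hIx : ∀ x ∈ Icc (σ - r) 1, x ∈ Ioc θ 1 := fun x hx => ⟨by linarith [hx.1], hx.2⟩
  have hIp : ∀ p ∈ Icc (σ - r) (σ + r), p ∈ Ioc θ 1 := fun p hp =>
    ⟨by linarith [hp.1], by linarith [hp.2]⟩
  have hmem : ∀ q ∈ Icc (σ - r) (σ + r) ×ˢ Icc (σ - r) 1,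
      (q.2, Real.exp (F q.1 - F q.2)) ∈ S := by
    rintro ⟨p, x⟩ ⟨hp, hx⟩
    have hx0 : x ∈ Icc (0 : ℝ) 1 := ⟨hθ.trans (hIx x hx).1.le, hx.2⟩
    have hy0 := Real.exp_pos (F p - F x)
    rcases le_total p x with hpx | hpx
    · refine hS ⟨hx0, hy0.le, Real.exp_le_one_iff.2 ?_⟩
      exact sub_nonpos.2 (hmono (hIp p hp) (hIx x hx) hpx)
    · refine hthick (Metric.mem_cthickening_of_dist_le _ (x, 1) _ _
        ⟨hx0, zero_le_one, le_rfl⟩ ?_)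
      have hd : dist (p, x) (σ, σ) < r₀ := by
        rw [Prod.dist_eq, max_lt_iff, Real.dist_eq, Real.dist_eq, abs_lt, abs_lt]
        simp only [mem_Icc] at hp hx
        constructor <;> constructor <;> simp only <;> linarith [hp.1, hp.2, hx.1, hx.2]
      have := hball hd
      simp only [sub_self, Real.exp_zero] at this
      simpa [Prod.dist_eq, hρ.le] using this.le
  have hF1 : ContinuousOn (fun q : ℝ × ℝ => F q.1)
      (Icc (σ - r) (σ + r) ×ˢ Icc (σ - r) 1) :=
    hFc.comp continuousOn_fst fun q hq => hIp q.1 hq.1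
  have hF2 : ContinuousOn (fun q : ℝ × ℝ => F q.2)
      (Icc (σ - r) (σ + r) ×ˢ Icc (σ - r) 1) :=
    hFc.comp continuousOn_snd fun q hq => hIx q.2 hq.2
  have hY : ContinuousOn (fun q : ℝ × ℝ => Real.exp (F q.1 - F q.2))
      (Icc (σ - r) (σ + r) ×ˢ Icc (σ - r) 1) := (hF1.sub hF2).rexp
  have hw2 : ContinuousOn (fun q : ℝ × ℝ => w q.2)
      (Icc (σ - r) (σ + r) ×ˢ Icc (σ - r) 1) :=
    hw.comp continuousOn_snd fun q hq => hIx q.2 hq.2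
  have hk1 : ContinuousOn (fun q : ℝ × ℝ => k q.1)
      (Icc (σ - r) (σ + r) ×ˢ Icc (σ - r) 1) :=
    hk.comp continuousOn_fst fun q hq => hIp q.1 hq.1
  have hpair := (continuousOn_snd (s := Icc (σ - r) (σ + r) ×ˢ Icc (σ - r) 1)).prodMk hY
  have main := hasDerivAt_integral_param_left (c := 1) (σ := σ) hr (by linarith)
    (h := fun p x => u (x, Real.exp (F p - F x)) * w x)
    (h' := fun p x => uy (x, Real.exp (F p - F x)) * (Real.exp (F p - F x) * k p) * w x)
    ((hu.comp hpair hmem).mul hw2)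
    (((huy.comp hpair hmem).mul (hY.mul hk1)).mul hw2)
    (fun p hp x hx => by
      have h1 := ((hF p (hIp p (Ioo_subset_Icc_self hp))).sub_const (F x)).exp
      have h2 := hder _ (hmem (p, x) ⟨Ioo_subset_Icc_self hp, hx⟩)
      exact (HasDerivAt.comp p h2 h1).mul_const (w x))
  simpa using main

/-- A function which is continuous at every point of `(θ, 1]` has a primitive there. -/
theorem exists_hasDerivAt_Ioc {k : ℝ → ℝ} {θ : ℝ}
    (hk : ∀ x ∈ Ioc θ 1, ∀ᶠ z in nhds x, ContinuousAt k z) :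
    ∃ F : ℝ → ℝ, ∀ x ∈ Ioc θ 1, HasDerivAt F (k x) x := by
  refine ⟨fun x => ∫ t in (1 : ℝ)..x, k t, fun x hx => ?_⟩
  obtain ⟨S, hS, hSo, hxS⟩ := eventually_nhds_iff.1 (hk x hx)
  refine intervalIntegral.integral_hasDerivAt_right ?_ ?_ (hk x hx).self_of_nhds
  · refine ContinuousOn.intervalIntegrable fun z hz => ?_
    have : z ∈ Ioc θ 1 := by
      have := uIcc_subset_Icc (a₂ := x) (b₂ := 1) ⟨hx.2, le_rfl⟩ ⟨le_rfl, hx.2⟩ hz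
      exact ⟨hx.1.trans_le this.1, this.2⟩
    exact (hk z this).self_of_nhds.continuousWithinAt
  · exact ContinuousOn.stronglyMeasurableAtFilter hSo
      (fun z hz => (hS z hz).continuousWithinAt) x hxS

/-- Solutions of `y' = -k y` are determined by their initial value. -/
theorem eq_exp_of_hasDerivWithinAt {F k y : ℝ → ℝ} {σ b : ℝ}
    (hF : ∀ x ∈ Icc σ b, HasDerivAt F (k x) x) (hyσ : y σ = 1)
    (hy : ∀ x ∈ Icc σ b, HasDerivWithinAt y (-(k x * y x)) (Icc σ b) x) :
    ∀ x ∈ Icc σ b, y x = Real.exp (F σ - F x) := by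
  intro x hx
  have hd : ∀ z ∈ Icc σ b,
      HasDerivWithinAt (fun z => y z * Real.exp (F z)) 0 (Icc σ b) z := fun z hz => by
    refine ((hy z hz).mul (hF z hz).exp.hasDerivWithinAt).congr_deriv ?_
    ring
  have hσb : σ ≤ b := hx.1.trans hx.2
  have key := constant_of_derivWithin_zero (fun z hz => (hd z hz).differentiableWithinAt)
    (fun z hz => (hd z ⟨hz.1, hz.2.le⟩).derivWithin
      (uniqueDiffOn_Icc (hz.1.trans_lt hz.2) z ⟨hz.1, hz.2.le⟩)) x hx
  simp only [hyσ, one_mul] at key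
  rw [Real.exp_sub, ← key]
  field_simp

/-- If `Y' = -k Y` with `k x ≥ N / x` near the starting point `σ`, then `Y` decays at least as
fast as `(σ / x) ^ N` there. -/
theorem decay_le {Y k : ℝ → ℝ} {σ d : ℝ} {N : ℕ} (hσ : 0 < σ) (hσd : σ < d) (hd1 : d ≤ 1)
    (hYσ : Y σ = 1) (hY0 : ∀ x ∈ Icc σ 1, 0 ≤ Y x)
    (hY : ∀ x ∈ Icc σ 1, HasDerivAt Y (-(k x * Y x)) x)
    (hk0 : ∀ x ∈ Icc σ 1, 0 ≤ k x) (hk : ∀ x ∈ Icc σ d, N ≤ x * k x) :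
    ∀ x ∈ Icc σ 1, Y x ≤ (σ / x) ^ N + (σ / d) ^ N := by
  have hanti : AntitoneOn Y (Icc σ 1) := by
    refine antitoneOn_of_deriv_nonpos (convex_Icc σ 1)
      (fun x hx => (hY x hx).continuousAt.continuousWithinAt)
      (fun x hx => (hY x (interior_subset hx)).differentiableAt.differentiableWithinAt) ?_
    intro x hx
    have hx := interior_subset hx
    rw [(hY x hx).deriv]
    exact neg_nonpos.2 (mul_nonneg (hk0 x hx) (hY0 x hx))
  have hsub : Icc σ d ⊆ Icc σ 1 := Icc_subset_Icc_right hd1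
  have hder : ∀ x ∈ Icc σ d, HasDerivAt (fun x => x ^ N * Y x)
      (N * x ^ (N - 1) * Y x + x ^ N * -(k x * Y x)) x := fun x hx =>
    (hasDerivAt_pow N x).mul (hY x (hsub hx))
  have hanti' : AntitoneOn (fun x => x ^ N * Y x) (Icc σ d) := by
    refine antitoneOn_of_deriv_nonpos (convex_Icc σ d)
      (fun x hx => (hder x hx).continuousAt.continuousWithinAt)
      (fun x hx => (hder x (interior_subset hx)).differentiableAt.differentiableWithinAt) ?_
    intro x hx
    have hx := interior_subset hx
    rw [(hder x hx).deriv]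
    rcases Nat.eq_zero_or_pos N with rfl | hN
    · have := mul_nonneg (hk0 x (hsub hx)) (hY0 x (hsub hx))
      simpa using this
    · obtain ⟨m, rfl⟩ : ∃ m, N = m + 1 := ⟨N - 1, by omega⟩
      have h1 := hk x hx
      have h2 : 0 ≤ x ^ m * Y x :=
        mul_nonneg (pow_nonneg (hσ.le.trans hx.1) m) (hY0 x (hsub hx))
      have h3 := mul_nonneg h2 (sub_nonneg.2 h1)
      simp only [Nat.add_sub_cancel]
      rw [pow_succ]
      nlinarith
  have hnear : ∀ x ∈ Icc σ d, Y x ≤ (σ / x) ^ N := fun x hx => by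
    have h := hanti' (left_mem_Icc.2 hσd.le) hx hx.1
    simp only [hYσ, mul_one] at h
    rw [div_pow, le_div_iff₀ (pow_pos (hσ.trans_le hx.1) N)]
    linarith
  intro x hx
  have hx0 : 0 < x := hσ.trans_le hx.1
  rcases le_total x d with hxd | hxd
  · have := hnear x ⟨hx.1, hxd⟩
    have : 0 ≤ (σ / d) ^ N := by have := hσ.trans hσd; positivity
    linarith
  · have h1 := hanti ⟨hσd.le, hd1⟩ hx hxd
    have h2 := hnear d ⟨hσd.le, le_rfl⟩
    have : 0 ≤ (σ / x) ^ N := by positivity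
    linarith

/-- The main estimate: `T'` is the weight `1 / (σ ^ μ - ε)` times the left hand side. -/
theorem dulac_bracket_le {u uy : ℝ × ℝ → ℝ} {V w k Y : ℝ → ℝ} {σ v C d : ℝ} {n : ℕ} (hn : 1 ≤ n)
    (hσ : 0 < σ) (hσ1 : σ < 1) (hv : 0 < v) (hd : 0 < d) (hd1 : d ≤ 1)
    (hVv : ∀ x ∈ Icc (0 : ℝ) 1, v ≤ V x) (hVC : ∀ x ∈ Icc (0 : ℝ) 1, V x ≤ C)
    (hVlip : ∀ x ∈ Icc (0 : ℝ) 1, ∀ x' ∈ Icc (0 : ℝ) 1, |V x - V x'| ≤ C * |x - x'|)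
    (hu : ∀ y ∈ Icc (0 : ℝ) 1, HasDerivAt (fun y => u (0, y)) (uy (0, y)) y)
    (hux : |u (σ, 1) - u (0, 1)| ≤ C * σ)
    (huy' : ∀ y ∈ Icc (0 : ℝ) 1, |u (0, y) - u (0, 0)| ≤ C * y)
    (huyC : ∀ x ∈ Icc (0 : ℝ) 1, ∀ y ∈ Icc (0 : ℝ) 1, |uy (x, y)| ≤ C)
    (huylip : ∀ x ∈ Icc (0 : ℝ) 1, ∀ y ∈ Icc (0 : ℝ) 1, |uy (x, y) - uy (0, y)| ≤ C * x)
    (hw0 : ∀ x ∈ Icc σ 1, 0 < w x) (hk : ∀ x ∈ Icc σ 1, k x = V x * w x / x)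
    (hYσ : Y σ = 1) (hY0 : ∀ x ∈ Icc σ 1, Y x ∈ Icc (0 : ℝ) 1)
    (hY : ∀ x ∈ Icc σ 1, HasDerivAt Y (-(k x * Y x)) x)
    (hdec : ∀ x ∈ Icc σ 1, Y x ≤ (σ / x) ^ (n + 1) + (σ / d) ^ (n + 1))
    (hintegrable : ContinuousOn (fun x => uy (x, Y x) * (Y x * (V σ / σ)) * w x) (Icc σ 1)) :
    -u (σ, 1) + ∫ x in σ..1, uy (x, Y x) * (Y x * (V σ / σ)) * w x ≤
      -u (0, 0) + (3 * C + 2 * (2 * C ^ 2 / v + C)) * (σ / d ^ (n + 1)) +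
        (2 * C ^ 2 / v + C) / n := by
  have hσI : σ ∈ Icc (0 : ℝ) 1 := ⟨hσ.le, hσ1.le⟩
  have hC : 0 < C := hv.trans_le ((hVv σ hσI).trans (hVC σ hσI))
  have hn0 : (0 : ℝ) < n := by exact_mod_cast hn
  have hsub : ∀ x ∈ Icc σ 1, x ∈ Icc (0 : ℝ) 1 := fun x hx => ⟨hσ.le.trans hx.1, hx.2⟩
  set B := 2 * C ^ 2 / v + C with hB
  have hB0 : 0 < B := by positivity
  set q := (σ / d) ^ (n + 1) with hq
  have hq0 : 0 < q := by positivity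
  let Ψ : ℝ → ℝ := fun x => -u (0, Y x) - B * (((x - σ) / σ + σ) * Y x) +
    B * (-((σ / x) ^ n / n) + x / σ * q)
  have hΨ : ∀ x ∈ Icc σ 1, HasDerivAt Ψ (uy (0, Y x) * (k x * Y x)
      - B * (1 / σ * Y x + ((x - σ) / σ + σ) * -(k x * Y x))
      + B * ((σ / x) ^ (n + 1) / σ + 1 / σ * q)) x := by
    intro x hx
    have hx0 : 0 < x := hσ.trans_le hx.1
    have h1 : HasDerivAt (fun x => u (0, Y x)) (uy (0, Y x) * -(k x * Y x)) x :=
      HasDerivAt.comp x (hu (Y x) (hY0 x hx)) (hY x hx)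
    have h2 : HasDerivAt (fun x => (x - σ) / σ + σ) (1 / σ) x :=
      (((hasDerivAt_id x).sub_const σ).div_const σ).add_const σ
    have h3 : HasDerivAt (fun x => (σ / x) ^ n) (n * (σ / x) ^ (n - 1) * (-σ / x ^ 2)) x := by
      have := ((hasDerivAt_const x σ).div (hasDerivAt_id x) hx0.ne').pow n
      refine HasDerivAt.congr_deriv this ?_
      simp
    have h4 : HasDerivAt (fun x => x / σ * q) (1 / σ * q) x :=
      ((hasDerivAt_id x).div_const σ).mul_const q
    refine ((h1.neg.sub ((h2.mul (hY x hx)).const_mul B)).add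
      (((h3.div_const (n : ℝ)).neg.add h4).const_mul B)).congr_deriv ?_
    have : -(n * (σ / x) ^ (n - 1) * (-σ / x ^ 2) / n) = (σ / x) ^ (n + 1) / σ := by
      obtain ⟨m, rfl⟩ : ∃ m, n = m + 1 := ⟨n - 1, by omega⟩
      simp only [Nat.add_sub_cancel, pow_succ]
      field_simp
    rw [this]
    ring
  have hmaj : ∀ x ∈ Ioo σ 1, uy (x, Y x) * (Y x * (V σ / σ)) * w x ≤
      uy (0, Y x) * (k x * Y x)
      - B * (1 / σ * Y x + ((x - σ) / σ + σ) * -(k x * Y x))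
      + B * ((σ / x) ^ (n + 1) / σ + 1 / σ * q) := by
    intro x hx
    have hx := Ioo_subset_Icc_self hx
    have hx0 : 0 < x := hσ.trans_le hx.1
    have hxI := hsub x hx
    have hVx : 0 < V x := hv.trans_le (hVv x hxI)
    have hy := hY0 x hx
    set g := V σ / σ * (x / V x) with hg
    have hrew : uy (x, Y x) * (Y x * (V σ / σ)) * w x = uy (x, Y x) * g * (k x * Y x) := by
      rw [hk x hx, hg]
      field_simp
    have hkY : 0 ≤ k x * Y x := by
      rw [hk x hx]
      have := hw0 x hx
      have := hy.1
      positivity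
    set t := (x - σ) / σ with ht
    have hxs : 0 ≤ x - σ := sub_nonneg.2 hx.1
    have ht0 : 0 ≤ t := div_nonneg hxs hσ.le
    have hts : x - σ ≤ t := by
      rw [ht, le_div_iff₀ hσ]
      nlinarith
    have hg1 : |g - 1| ≤ 2 * C / v * t := by
      have : g - 1 = (V σ * t + (V σ - V x)) / V x := by
        rw [hg, ht]
        field_simp
        ring
      rw [this, abs_div, abs_of_pos hVx, div_le_iff₀ hVx]
      have h1 : |V σ * t + (V σ - V x)| ≤ C * t + C * (x - σ) := by
        refine (abs_add_le _ _).trans (add_le_add ?_ ?_)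
        · rw [abs_mul, abs_of_nonneg ht0, abs_of_pos (hv.trans_le (hVv σ hσI))]
          exact mul_le_mul_of_nonneg_right (hVC σ hσI) ht0
        · refine (hVlip σ hσI x hxI).trans_eq ?_
          rw [abs_sub_comm, abs_of_nonneg hxs]
      have h2 : C * (x - σ) ≤ C * t := mul_le_mul_of_nonneg_left hts hC.le
      have h3 : 2 * C / v * t * v ≤ 2 * C / v * t * V x :=
        mul_le_mul_of_nonneg_left (hVv x hxI) (by positivity)
      have h4 : 2 * C / v * t * v = 2 * C * t := by field_simp
      linarith
    have hdiff : uy (x, Y x) * g ≤ uy (0, Y x) + B * (t + σ) := by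
      have h1 : uy (x, Y x) * (g - 1) ≤ C * (2 * C / v * t) :=
        (le_abs_self _).trans (by
          rw [abs_mul]
          exact mul_le_mul (huyC x hxI _ hy) hg1 (abs_nonneg _) hC.le)
      have h2 := (le_abs_self _).trans (huylip x hxI _ hy)
      have h3 : C * x ≤ C * (t + σ) := mul_le_mul_of_nonneg_left (by linarith) hC.le
      have h4 : C * (2 * C / v * t) = 2 * C ^ 2 / v * t := by ring
      have h5 : 0 ≤ 2 * C ^ 2 / v * σ := by positivity
      rw [hB]
      nlinarith
    have hlast : 1 / σ * Y x ≤ (σ / x) ^ (n + 1) / σ + 1 / σ * q := by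
      have := mul_le_mul_of_nonneg_left (hdec x hx) (one_div_pos.2 hσ).le
      rw [mul_add] at this
      refine this.trans_eq ?_
      ring
    rw [hrew]
    have h1 := mul_le_mul_of_nonneg_right hdiff hkY
    have h2 := mul_le_mul_of_nonneg_left hlast hB0.le
    nlinarith
  have key := intervalIntegral.integral_le_sub_of_hasDeriv_right_of_le hσ1.le
    (fun x hx => (hΨ x hx).continuousAt.continuousWithinAt)
    (fun x hx => (hΨ x (Ioo_subset_Icc_self hx)).hasDerivWithinAt)
    hintegrable.integrableOn_Icc hmaj
  have h1mem : (1 : ℝ) ∈ Icc σ 1 := ⟨hσ1.le, le_rfl⟩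
  have hY1 := hY0 1 h1mem
  have hΨ1 : Ψ 1 ≤ -u (0, Y 1) + B * (1 / σ * q) := by
    have h1 : 0 ≤ ((1 - σ) / σ + σ) * Y 1 := by
      have := hY1.1
      have : 0 ≤ 1 - σ := by linarith
      positivity
    have h2 : 0 ≤ (σ / 1) ^ n / n := by positivity
    simp only [Ψ]
    nlinarith [mul_nonneg hB0.le h1, mul_nonneg hB0.le h2]
  have hΨσ : Ψ σ = -u (0, 1) - B * σ + B * (-(1 / n) + q) := by
    simp only [Ψ, hYσ, div_self hσ.ne']
    simp
  have hdn : d ^ (n + 1) ≤ 1 := pow_le_one₀ hd.le hd1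
  set D := σ / d ^ (n + 1) with hD
  have hσD : σ ≤ D := by
    rw [hD, le_div_iff₀ (by positivity)]
    nlinarith
  have hqD : 1 / σ * q ≤ D := by
    have : 1 / σ * q = σ ^ n / d ^ (n + 1) := by
      rw [hq, div_pow, pow_succ σ]
      field_simp
    rw [this, hD]
    gcongr
    calc σ ^ n ≤ σ ^ 1 := pow_le_pow_of_le_one hσ.le hσ1.le hn
      _ = σ := pow_one σ
  have hqD' : q ≤ D := by
    refine le_trans ?_ hqD
    have : 1 ≤ 1 / σ := by rw [le_div_iff₀ hσ]; linarith
    nlinarith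
  have hY1D : Y 1 ≤ 2 * D := by
    have h1 := hdec 1 h1mem
    have h2 : (σ / 1) ^ (n + 1) ≤ σ := by
      rw [div_one]
      calc σ ^ (n + 1) ≤ σ ^ 1 := pow_le_pow_of_le_one hσ.le hσ1.le (by omega)
        _ = σ := pow_one σ
    linarith
  have h3 := (abs_le.1 (huy' (Y 1) hY1)).1
  have h4 := (abs_le.1 hux).1
  have h5 : C * Y 1 ≤ C * (2 * D) := mul_le_mul_of_nonneg_left hY1D hC.le
  have h6 : C * σ ≤ C * D := mul_le_mul_of_nonneg_left hσD hC.le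
  have h7 : B * σ ≤ B * D := mul_le_mul_of_nonneg_left hσD hB0.le
  have h8 : B * (1 / σ * q) ≤ B * D := mul_le_mul_of_nonneg_left hqD hB0.le
  have h9 : B / n = B * (1 / n) := by ring
  have h10 : 0 ≤ B * q := by positivity
  rw [hΨσ] at key
  rw [h9]
  linarith

/-- For a fixed parameter value, an upper bound for the derivative of the Dulac time. -/
theorem deriv_dulac_time_le {S : Set (ℝ × ℝ)} (hSo : IsOpen S)
    (hS : Icc (0 : ℝ) 1 ×ˢ Icc (0 : ℝ) 1 ⊆ S) {u uy : ℝ × ℝ → ℝ} (hu : ContinuousOn u S)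
    (huy : ContinuousOn uy S)
    (hder : ∀ q ∈ S, HasDerivAt (fun y => u (q.1, y)) (uy q) q.2)
    {V T : ℝ → ℝ} {y : ℝ → ℝ → ℝ} {μ n : ℕ} {ε s s₀ v C d : ℝ} (hμ : 1 ≤ μ) (hn : 1 ≤ n)
    (hs : s ∈ Ioo 0 s₀) (hσ1 : s + theta μ ε < d) (hv : 0 < v) (hd1 : d ≤ 1)
    (hdv : d + |ε| ≤ v / (n + 1))
    (hVcont : ∀ x ∈ Icc (0 : ℝ) 1, ∀ᶠ z in nhds x, ContinuousAt V z)
    (hVv : ∀ x ∈ Icc (0 : ℝ) 1, v ≤ V x) (hVC : ∀ x ∈ Icc (0 : ℝ) 1, V x ≤ C)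
    (hVlip : ∀ x ∈ Icc (0 : ℝ) 1, ∀ x' ∈ Icc (0 : ℝ) 1, |V x - V x'| ≤ C * |x - x'|)
    (hux : ∀ x ∈ Icc (0 : ℝ) 1, |u (x, 1) - u (0, 1)| ≤ C * x)
    (huy' : ∀ y ∈ Icc (0 : ℝ) 1, |u (0, y) - u (0, 0)| ≤ C * y)
    (huyC : ∀ x ∈ Icc (0 : ℝ) 1, ∀ y ∈ Icc (0 : ℝ) 1, |uy (x, y)| ≤ C)
    (huylip : ∀ x ∈ Icc (0 : ℝ) 1, ∀ y ∈ Icc (0 : ℝ) 1, |uy (x, y) - uy (0, y)| ≤ C * x)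
    (hy : ∀ s ∈ Ioc (0 : ℝ) s₀, y s (s + theta μ ε) = 1 ∧
      ∀ x ∈ Icc (s + theta μ ε) 1, HasDerivWithinAt (y s)
        (-(V x * y s x) / (x * (x ^ μ - ε))) (Icc (s + theta μ ε) 1) x)
    (hT : ∀ s ∈ Ioc (0 : ℝ) s₀,
      T s = ∫ x in (s + theta μ ε)..1, u (x, y s x) / (x ^ μ - ε)) :
    deriv T s ≤ ((s + theta μ ε) ^ μ - ε)⁻¹ * (-u (0, 0) +
      (3 * C + 2 * (2 * C ^ 2 / v + C)) * ((s + theta μ ε) / d ^ (n + 1)) +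
        (2 * C ^ 2 / v + C) / n) := by
  have hθ0 := theta_nonneg μ ε
  set θ := theta μ ε with hθ
  set σ := s + θ with hσ
  have hσθ : θ < σ := by linarith [hs.1]
  have hσ0 : 0 < σ := hθ0.trans_lt hσθ
  have hσ1' : σ < 1 := hσ1.trans_le hd1
  have hIoc : ∀ x ∈ Ioc θ 1, 0 < x ∧ 0 < x ^ μ - ε := fun x hx =>
    ⟨hθ0.trans_lt hx.1, sub_pos.2 (lt_pow_of_theta_lt hμ hx.1)⟩
  have hIcc : ∀ x ∈ Icc σ 1, x ∈ Ioc θ 1 := fun x hx => ⟨hσθ.trans_le hx.1, hx.2⟩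
  let w : ℝ → ℝ := fun x => (x ^ μ - ε)⁻¹
  let k : ℝ → ℝ := fun x => V x * w x / x
  have hkev : ∀ x ∈ Ioc θ 1, ∀ᶠ z in nhds x, ContinuousAt k z := by
    intro x hx
    have hpos : ∀ᶠ z : ℝ in nhds x, z ≠ 0 ∧ z ^ μ - ε ≠ 0 :=
      (continuousAt_id.eventually_ne (hIoc x hx).1.ne').and
        (ContinuousAt.eventually_ne (by fun_prop) (hIoc x hx).2.ne')
    filter_upwards [hpos, hVcont x ⟨(hIoc x hx).1.le, hx.2⟩] with z hz hVz
    exact (hVz.mul (ContinuousAt.inv₀ (by fun_prop) hz.2)).div continuousAt_id hz.1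
  have hk : ContinuousOn k (Ioc θ 1) := fun x hx =>
    (hkev x hx).self_of_nhds.continuousWithinAt
  have hw : ContinuousOn w (Ioc θ 1) :=
    ContinuousOn.inv₀ (by fun_prop) fun x hx => (hIoc x hx).2.ne'
  have hw0 : ∀ x ∈ Ioc θ 1, 0 < w x := fun x hx => inv_pos.2 (hIoc x hx).2
  have hk0 : ∀ x ∈ Ioc θ 1, 0 ≤ k x := fun x hx => by
    have h1 := hw0 x hx
    have h2 := (hIoc x hx).1
    have h3 := hv.le.trans (hVv x ⟨h2.le, hx.2⟩)
    positivity
  obtain ⟨F, hF⟩ := exists_hasDerivAt_Ioc hkev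
  have hTder := hasDerivAt_dulac_integral hSo hS hu huy hder hθ0 hσθ hσ1' hF hk hk0 hw
  have hTs : HasDerivAt T (-(u (σ, 1) * w σ) + ∫ x in σ..1,
      uy (x, Real.exp (F σ - F x)) * (Real.exp (F σ - F x) * k σ) * w x) s := by
    refine (hTder.comp_add_const s θ).congr_of_eventuallyEq ?_
    have hnb : Ioo 0 (min s₀ (1 - θ)) ∈ nhds s :=
      Ioo_mem_nhds hs.1 (lt_min hs.2 (by linarith))
    filter_upwards [hnb] with s' hs'
    have h1 : s' ∈ Ioc 0 s₀ := ⟨hs'.1, (hs'.2.trans_le (min_le_left _ _)).le⟩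
    have h2 : s' + θ < 1 := by linarith [hs'.2.trans_le (min_le_right s₀ (1 - θ))]
    have hI : ∀ x ∈ Icc (s' + θ) 1, x ∈ Ioc θ 1 := fun x hx =>
      ⟨by linarith [hx.1, hs'.1], hx.2⟩
    rw [hT s' h1]
    refine intervalIntegral.integral_congr fun x hx => ?_
    rw [uIcc_of_le h2.le] at hx
    have := eq_exp_of_hasDerivWithinAt (fun z hz => hF z (hI z hz)) (hy s' h1).1
      (fun z hz => ((hy s' h1).2 z hz).congr_deriv (by
        have := hIoc z (hI z hz)
        have h3 := this.1.ne'
        have h4 := this.2.ne'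
        simp only [k, w]
        field_simp)) x hx
    simp only [this, w, div_eq_mul_inv]
  set Y : ℝ → ℝ := fun x => Real.exp (F σ - F x) with hY
  have hYσ : Y σ = 1 := by simp [hY]
  have hYder : ∀ x ∈ Icc σ 1, HasDerivAt Y (-(k x * Y x)) x := fun x hx => by
    refine ((hF x (hIcc x hx)).const_sub (F σ)).exp.congr_deriv ?_
    simp only [hY]
    ring
  have hFmono : MonotoneOn F (Icc σ 1) := by
    refine monotoneOn_of_deriv_nonneg (convex_Icc σ 1)
      (fun x hx => (hF x (hIcc x hx)).continuousAt.continuousWithinAt)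
      (fun x hx =>
        (hF x (hIcc x (interior_subset hx))).differentiableAt.differentiableWithinAt) ?_
    intro x hx
    rw [(hF x (hIcc x (interior_subset hx))).deriv]
    exact hk0 x (hIcc x (interior_subset hx))
  have hY0 : ∀ x ∈ Icc σ 1, Y x ∈ Icc (0 : ℝ) 1 := fun x hx =>
    ⟨(Real.exp_pos _).le, Real.exp_le_one_iff.2
      (sub_nonpos.2 (hFmono (left_mem_Icc.2 hσ1'.le) hx hx.1))⟩
  have hYc : ContinuousOn Y (Icc σ 1) := fun x hx =>
    (hYder x hx).continuousAt.continuousWithinAt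
  have hdec := decay_le (N := n + 1) hσ0 hσ1 hd1 hYσ (fun x hx => (hY0 x hx).1) hYder
    (fun x hx => hk0 x (hIcc x hx)) (fun x hx => by
      have hx1 : x ∈ Icc σ 1 := ⟨hx.1, hx.2.trans hd1⟩
      obtain ⟨hx0, hxε⟩ := hIoc x (hIcc x hx1)
      have h1 : x * k x = V x / (x ^ μ - ε) := by
        simp only [k, w]
        field_simp
      have h2 : x ^ μ ≤ x := by
        calc x ^ μ ≤ x ^ 1 := pow_le_pow_of_le_one hx0.le hx1.2 hμ
          _ = x := pow_one x
      have h3 : x ^ μ - ε ≤ v / (n + 1) := by linarith [hx.2, neg_le_abs ε]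
      have h4 := hVv x ⟨hx0.le, hx1.2⟩
      rw [h1, le_div_iff₀ hxε]
      rw [le_div_iff₀ (by positivity)] at h3
      push_cast
      linarith)
  have hintegrable : ContinuousOn (fun x => uy (x, Y x) * (Y x * (V σ / σ)) * w x) (Icc σ 1) :=
    ((huy.comp (continuousOn_id.prodMk hYc) fun x hx =>
      hS ⟨⟨hσ0.le.trans hx.1, hx.2⟩, hY0 x hx⟩).mul (hYc.mul continuousOn_const)).mul
      (hw.mono hIcc)
  have key := dulac_bracket_le hn hσ0 hσ1' hv (hσ0.trans hσ1) hd1 hVv hVC hVlip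
    (fun y hy => hder (0, y) (hS ⟨⟨le_rfl, zero_le_one⟩, hy⟩)) (hux σ ⟨hσ0.le, hσ1'.le⟩) huy'
    huyC huylip (fun x hx => hw0 x (hIcc x hx)) (fun x _ => rfl) hYσ hY0 hYder hdec hintegrable
  have hfac : (-(u (σ, 1) * w σ) + ∫ x in σ..1, uy (x, Y x) * (Y x * k σ) * w x) =
      (σ ^ μ - ε)⁻¹ * (-u (σ, 1) + ∫ x in σ..1, uy (x, Y x) * (Y x * (V σ / σ)) * w x) := by
    rw [mul_add, ← intervalIntegral.integral_const_mul]
    congr 1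
    · simp only [w]
      ring
    · refine intervalIntegral.integral_congr fun x _ => ?_
      simp only [k, w]
      ring
  rw [hTs.deriv, hfac]
  exact mul_le_mul_of_nonneg_left key (hw0 σ ⟨hσθ, hσ1'.le⟩).le

/-- **Theorem A.** The derivative of the Dulac time `T(s; ε, a)` of the saddle-node
unfolding `X = (1/(x U_a(x,y))) (x (x^μ - ε) ∂_x - V_a(x) y ∂_y)` between the transverse
sections `{y = 1}` and `{x = 1}` tends to `-∞` as `(s, ε) → (0⁺, 0)`, uniformly with
respect to `a` on every compact subset of `A`. -/
theorem dulac_time_deriv_tendsto_neg_infty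
    {α : ℕ} (μ : ℕ) (hμ : 1 ≤ μ)
    (A : Set (Fin α → ℝ)) (hA : IsOpen A)
    (U : ℝ → ℝ → (Fin α → ℝ) → ℝ)
    (hUan : AnalyticOnNhd ℝ (fun p : ℝ × ℝ × (Fin α → ℝ) => U p.1 p.2.1 p.2.2)
      ((Set.Icc (-1 : ℝ) 1) ×ˢ (Set.Icc (-1 : ℝ) 1) ×ˢ A))
    (hU0 : ∀ a ∈ A, 0 < U 0 0 a)
    (hUtaylor : ∀ a ∈ A, ∃ c : ℕ × ℕ → ℝ, Summable (fun p => |c p|) ∧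
      ∀ x ∈ Set.Icc (-1 : ℝ) 1, ∀ y' ∈ Set.Icc (-1 : ℝ) 1,
        HasSum (fun p : ℕ × ℕ => c p * x ^ p.1 * y' ^ p.2) (U x y' a))
    (V : ℝ → (Fin α → ℝ) → ℝ)
    (hVan : AnalyticOnNhd ℝ (fun p : ℝ × (Fin α → ℝ) => V p.1 p.2)
      ((Set.Icc (-1 : ℝ) 1) ×ˢ A))
    (hVpos : ∀ x ∈ Set.Icc (-1 : ℝ) 1, ∀ a ∈ A, 0 < V x a)
    (s₀ ε₀ : ℝ) (hs₀ : 0 < s₀) (hε₀ : 0 < ε₀)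
    -- `y (·; s, ε, a)` is the solution of `y' = -V(x,a) y/(x(x^μ-ε))` with
    -- initial condition `y (s+ϑ_ε) = 1`:
    (y : ℝ → ℝ → ℝ → (Fin α → ℝ) → ℝ)
    (hy : ∀ a ∈ A, ∀ s ∈ Set.Ioc (0 : ℝ) s₀, ∀ ε ∈ Set.Icc (-ε₀) ε₀,
      y (s + theta μ ε) s ε a = 1 ∧
      ∀ x ∈ Set.Icc (s + theta μ ε) 1,
        HasDerivWithinAt (fun x' => y x' s ε a)
          (-(V x a * y x s ε a) / (x * (x ^ μ - ε))) (Set.Icc (s + theta μ ε) 1) x)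
    -- the Dulac time:
    (T : ℝ → ℝ → (Fin α → ℝ) → ℝ)
    (hT : ∀ a ∈ A, ∀ s ∈ Set.Ioc (0 : ℝ) s₀, ∀ ε ∈ Set.Icc (-ε₀) ε₀,
      T s ε a = ∫ x in (s + theta μ ε)..1, U x (y x s ε a) a / (x ^ μ - ε)) :
    ∀ K ⊆ A, IsCompact K → ∀ M > 0, ∃ δ > 0, ∀ s ε : ℝ, ∀ a ∈ K,
      0 < s → s < δ → |ε| < δ → deriv (fun s' => T s' ε a) s < -M := by
  intro K hKA hKc M hM
  have hQc : IsCompact (Icc (-1 : ℝ) 1 ×ˢ Icc (-1 : ℝ) 1 ×ˢ K) :=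
    isCompact_Icc.prod (isCompact_Icc.prod hKc)
  have hQsub : Icc (-1 : ℝ) 1 ×ˢ Icc (-1 : ℝ) 1 ×ˢ K ⊆ Icc (-1 : ℝ) 1 ×ˢ Icc (-1 : ℝ) 1 ×ˢ A :=
    prod_mono_right (prod_mono_right hKA)
  set f : ℝ × ℝ × (Fin α → ℝ) → ℝ := fun p => U p.1 p.2.1 p.2.2 with hf
  set g : ℝ × ℝ × (Fin α → ℝ) → ℝ := fun p => fderiv ℝ f p (0, 1, 0) with hg
  have hgan : AnalyticOnNhd ℝ g (Icc (-1 : ℝ) 1 ×ˢ Icc (-1 : ℝ) 1 ×ˢ A) := fun p hp =>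
    ((ContinuousLinearMap.apply ℝ ℝ ((0, 1, 0) : ℝ × ℝ × (Fin α → ℝ))).analyticAt _).comp
      (hUan p hp).fderiv
  obtain ⟨Cf, -, hCf⟩ := (hUan.mono hQsub).exists_bound_lipschitz_segment hQc
  obtain ⟨Cg, hCg, hCg'⟩ := (hgan.mono hQsub).exists_bound_lipschitz_segment hQc
  obtain ⟨CV, hCV, hCV'⟩ := (hVan.mono (prod_mono_right hKA)).exists_bound_lipschitz_segment
    (isCompact_Icc.prod hKc)
  set C := max Cf (max Cg CV) with hC
  have hCfC : Cf ≤ C := le_max_left _ _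
  have hCgC : Cg ≤ C := (le_max_left _ _).trans (le_max_right _ _)
  have hCVC : CV ≤ C := (le_max_right _ _).trans (le_max_right _ _)
  have h01 : ∀ x ∈ Icc (0 : ℝ) 1, x ∈ Icc (-1 : ℝ) 1 := fun x hx => ⟨by linarith [hx.1], hx.2⟩
  have hzero : (0 : ℝ) ∈ Icc (-1 : ℝ) 1 := by simp
  have hsegV : ∀ a ∈ K, ∀ x ∈ Icc (-1 : ℝ) 1, ∀ x' ∈ Icc (-1 : ℝ) 1,
      segment ℝ (x, a) (x', a) ⊆ Icc (-1 : ℝ) 1 ×ˢ K := fun a ha x hx x' hx' =>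
    (((convex_Icc (-1 : ℝ) 1).prod (convex_singleton a)).segment_subset
      ⟨hx, mem_singleton a⟩ ⟨hx', mem_singleton a⟩).trans (prod_mono_right (singleton_subset_iff.2 ha))
  have hsegU : ∀ a ∈ K, ∀ x ∈ Icc (-1 : ℝ) 1, ∀ x' ∈ Icc (-1 : ℝ) 1,
      ∀ z ∈ Icc (-1 : ℝ) 1, ∀ z' ∈ Icc (-1 : ℝ) 1,
      segment ℝ (x, z, a) (x', z', a) ⊆ Icc (-1 : ℝ) 1 ×ˢ Icc (-1 : ℝ) 1 ×ˢ K :=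
    fun a ha x hx x' hx' z hz z' hz' =>
    (((convex_Icc (-1 : ℝ) 1).prod
      ((convex_Icc (-1 : ℝ) 1).prod (convex_singleton a))).segment_subset
      ⟨hx, hz, mem_singleton a⟩ ⟨hx', hz', mem_singleton a⟩).trans
      (prod_mono_right (prod_mono_right (singleton_subset_iff.2 ha)))
  obtain ⟨c₀, hc₀, hc₀K⟩ := hKc.exists_forall_le' (f := fun a => U 0 0 a) (a := 0)
    (fun a ha => by
      have h1 : ContinuousAt (fun a => ((0 : ℝ), (0 : ℝ), a)) a := by fun_prop
      exact (ContinuousAt.comp (f := fun a => ((0 : ℝ), (0 : ℝ), a))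
        (hUan (0, 0, a) ⟨hzero, hzero, hKA ha⟩).continuousAt h1).continuousWithinAt)
    (fun a ha => hU0 a (hKA ha))
  obtain ⟨v, hv, hvK⟩ := (isCompact_Icc.prod hKc).exists_forall_le'
    (hVan.mono (prod_mono_right hKA)).continuousOn (a := 0)
    (fun p hp => hVpos p.1 hp.1 p.2 (hKA hp.2))
  set B := 2 * C ^ 2 / v + C with hB
  obtain ⟨n, hnB⟩ := exists_nat_gt (max 1 (4 * B / c₀))
  have hn1 : 1 ≤ n := by exact_mod_cast ((le_max_left 1 (4 * B / c₀)).trans_lt hnB).le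
  have hn0 : (0 : ℝ) < n := by exact_mod_cast hn1
  have hBn : B / n ≤ c₀ / 4 := by
    have := (le_max_right 1 (4 * B / c₀)).trans_lt hnB
    rw [div_lt_iff₀ hc₀] at this
    rw [div_le_iff₀ hn0]
    linarith
  have hvn : 0 < v / (n + 1) := by positivity
  obtain ⟨d, hd, hd1, hdv⟩ : ∃ d > 0, d ≤ 1 ∧ d ≤ v / (n + 1) / 2 :=
    ⟨min 1 (v / (n + 1) / 2), lt_min one_pos (half_pos hvn), min_le_left _ _, min_le_right _ _⟩
  set D := |3 * C + 2 * B| / d ^ (n + 1) with hD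
  have hD0 : 0 ≤ D := by positivity
  obtain ⟨ρ, hρ, hρd, hρD, hρM⟩ : ∃ ρ > 0, ρ ≤ d ∧ ρ * D ≤ c₀ / 4 ∧ ρ < c₀ / (4 * M) := by
    refine ⟨min d (min (c₀ / 4 / (D + 1)) (c₀ / (4 * M) / 2)), ?_, min_le_left _ _, ?_, ?_⟩
    · have := hM
      exact lt_min hd (lt_min (by positivity) (by positivity))
    · have h1 := (min_le_right d (min (c₀ / 4 / (D + 1)) (c₀ / (4 * M) / 2))).trans
        (min_le_left _ _)
      calc _ ≤ c₀ / 4 / (D + 1) * D := mul_le_mul_of_nonneg_right h1 hD0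
        _ ≤ c₀ / 4 / (D + 1) * (D + 1) :=
          mul_le_mul_of_nonneg_left (by linarith) (by positivity)
        _ = c₀ / 4 := by field_simp
    · have h1 := (min_le_right d (min (c₀ / 4 / (D + 1)) (c₀ / (4 * M) / 2))).trans
        (min_le_right _ _)
      have : 0 < c₀ / (4 * M) := div_pos hc₀ (by linarith)
      linarith
  refine ⟨min (min s₀ ε₀) ((ρ / 2) ^ μ), lt_min (lt_min hs₀ hε₀) (by positivity), ?_⟩
  intro s ε a ha hs0 hsδ hεδ
  have hss₀ : s < s₀ := hsδ.trans_le ((min_le_left _ _).trans (min_le_left _ _))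
  have hεε₀ : ε ∈ Icc (-ε₀) ε₀ :=
    abs_le.1 (hεδ.trans_le ((min_le_left _ _).trans (min_le_right _ _))).le
  have hpow : (ρ / 2) ^ μ ≤ ρ / 2 := by
    calc (ρ / 2) ^ μ ≤ (ρ / 2) ^ 1 :=
          pow_le_pow_of_le_one (by linarith) (by linarith) hμ
      _ = ρ / 2 := pow_one _
  have hεpow : |ε| < (ρ / 2) ^ μ := hεδ.trans_le (min_le_right _ _)
  have hsρ : s < ρ / 2 := (hsδ.trans_le (min_le_right _ _)).trans_le hpow
  have hθρ : theta μ ε < ρ / 2 :=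
    theta_lt_of_lt_pow hμ (by linarith) ((le_abs_self ε).trans_lt hεpow)
  have hθ0 := theta_nonneg μ ε
  have haA := hKA ha
  have hlipU : ∀ x ∈ Icc (0 : ℝ) 1, ∀ x' ∈ Icc (0 : ℝ) 1, ∀ z ∈ Icc (0 : ℝ) 1,
      ∀ z' ∈ Icc (0 : ℝ) 1, |f (x, z, a) - f (x', z', a)| ≤ C * max |x - x'| |z - z'| ∧
        |g (x, z, a) - g (x', z', a)| ≤ C * max |x - x'| |z - z'| := by
    intro x hx x' hx' z hz z' hz'
    have hs := hsegU a ha x (h01 x hx) x' (h01 x' hx') z (h01 z hz) z' (h01 z' hz')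
    have hn : ‖((x, z, a) : ℝ × ℝ × (Fin α → ℝ)) - (x', z', a)‖ = max |x - x'| |z - z'| := by
      simp [Prod.norm_def]
    have hm : 0 ≤ max |x - x'| |z - z'| := (abs_nonneg _).trans (le_max_left _ _)
    have h1 := hCf _ ⟨h01 x hx, h01 z hz, ha⟩ _ ⟨h01 x' hx', h01 z' hz', ha⟩ hs
    have h2 := hCg' _ ⟨h01 x hx, h01 z hz, ha⟩ _ ⟨h01 x' hx', h01 z' hz', ha⟩ hs
    rw [hn] at h1 h2
    exact ⟨h1.trans (mul_le_mul_of_nonneg_right hCfC hm),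
      h2.trans (mul_le_mul_of_nonneg_right hCgC hm)⟩
  have hι : Continuous fun q : ℝ × ℝ => (q.1, q.2, a) := by fun_prop
  have hmemA : ∀ q ∈ Icc (0 : ℝ) 1 ×ˢ Icc (0 : ℝ) 1,
      (q.1, q.2, a) ∈ Icc (-1 : ℝ) 1 ×ˢ Icc (-1 : ℝ) 1 ×ˢ A :=
    fun q hq => ⟨h01 _ hq.1, h01 _ hq.2, haA⟩
  have h00 : (0 : ℝ) ∈ Icc (0 : ℝ) 1 := by simp
  have h11 : (1 : ℝ) ∈ Icc (0 : ℝ) 1 := by simp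
  have key := deriv_dulac_time_le (S := (fun q : ℝ × ℝ => (q.1, q.2, a)) ⁻¹'
      {p | AnalyticAt ℝ f p}) ((isOpen_analyticAt ℝ f).preimage hι)
    (fun q hq => hUan _ (hmemA q hq))
    (u := fun q => f (q.1, q.2, a)) (uy := fun q => g (q.1, q.2, a))
    (fun q hq => (ContinuousAt.comp (f := fun q : ℝ × ℝ => (q.1, q.2, a))
      (AnalyticAt.continuousAt hq) hι.continuousAt).continuousWithinAt)
    (fun q hq => (ContinuousAt.comp (f := fun q : ℝ × ℝ => (q.1, q.2, a)) (g := g)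
      ((ContinuousLinearMap.apply ℝ ℝ ((0, 1, 0) : ℝ × ℝ × (Fin α → ℝ))).continuous.continuousAt.comp
        (AnalyticAt.fderiv hq).continuousAt) hι.continuousAt).continuousWithinAt)
    (fun q hq => by
      have h1 : HasDerivAt (fun z : ℝ => (q.1, z, a)) ((0 : ℝ), (1 : ℝ), (0 : Fin α → ℝ)) q.2 :=
        (hasDerivAt_const q.2 q.1).prodMk ((hasDerivAt_id q.2).prodMk (hasDerivAt_const q.2 a))
      exact (AnalyticAt.differentiableAt hq).hasFDerivAt.comp_hasDerivAt q.2 h1)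
    (V := fun x => V x a) (T := fun s => T s ε a) (y := fun s x => y x s ε a)
    (C := C) (n := n) hμ hn1 ⟨hs0, hss₀⟩ (show s + theta μ ε < d by linarith) hv hd1
    (by linarith)
    (fun x hx => by
      have h1 : ContinuousAt (fun z : ℝ => (z, a)) x := by fun_prop
      filter_upwards [h1.eventually ((hVan (x, a) ⟨h01 x hx, haA⟩).eventually_analyticAt)]
        with z hz
      have h2 : ContinuousAt (fun z : ℝ => (z, a)) z := by fun_prop
      exact ContinuousAt.comp (f := fun z : ℝ => (z, a)) hz.continuousAt h2)
    (fun x hx => hvK (x, a) ⟨h01 x hx, ha⟩)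
    (fun x hx => (le_abs_self _).trans ((hCV (x, a) ⟨h01 x hx, ha⟩).trans hCVC))
    (fun x hx x' hx' => by
      have h1 := hCV' _ ⟨h01 x hx, ha⟩ _ ⟨h01 x' hx', ha⟩
        (hsegV a ha x (h01 x hx) x' (h01 x' hx'))
      have hn : ‖((x, a) : ℝ × (Fin α → ℝ)) - (x', a)‖ = |x - x'| := by
        simp [Prod.norm_def]
      rw [hn] at h1
      exact h1.trans (mul_le_mul_of_nonneg_right hCVC (abs_nonneg _)))
    (fun x hx => by simpa [abs_of_nonneg hx.1, hx.1] using (hlipU x hx 0 h00 1 h11 1 h11).1)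
    (fun z hz => by simpa [abs_of_nonneg hz.1, hz.1] using (hlipU 0 h00 0 h00 z hz 0 h00).1)
    (fun x hx z hz => (hCg _ ⟨h01 x hx, h01 z hz, ha⟩).trans hCgC)
    (fun x hx z hz => by
      simpa [abs_of_nonneg hx.1, hx.1] using (hlipU x hx 0 h00 z hz z hz).2)
    (fun s hs => hy a haA s hs ε hεε₀) (fun s hs => hT a haA s hs ε hεε₀)
  refine key.trans_lt ?_
  set σ := s + theta μ ε with hσ
  have hσ0 : 0 < σ := by linarith
  have hσρ : σ < ρ := by linarith
  have hwpos : 0 < σ ^ μ - ε := sub_pos.2 (lt_pow_of_theta_lt hμ (by linarith))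
  have hσpow : σ ^ μ ≤ σ := by
    calc σ ^ μ ≤ σ ^ 1 := pow_le_pow_of_le_one hσ0.le (by linarith) hμ
      _ = σ := pow_one σ
  have hwlt : σ ^ μ - ε < 2 * ρ := by linarith [neg_le_abs ε]
  have hmid : (3 * C + 2 * B) * (σ / d ^ (n + 1)) ≤ c₀ / 4 := by
    calc (3 * C + 2 * B) * (σ / d ^ (n + 1)) ≤ |3 * C + 2 * B| * (σ / d ^ (n + 1)) :=
          mul_le_mul_of_nonneg_right (le_abs_self _) (by positivity)
      _ = σ * D := by rw [hD]; ring
      _ ≤ ρ * D := mul_le_mul_of_nonneg_right hσρ.le hD0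
      _ ≤ c₀ / 4 := hρD
  have h0 : c₀ ≤ f (0, 0, a) := hc₀K a ha
  have hMw : M * (σ ^ μ - ε) < c₀ / 2 := by
    rw [lt_div_iff₀ (by linarith)] at hρM
    nlinarith
  rw [inv_mul_lt_iff₀ hwpos]
  linarith
end

section
/- Let K be a compact subset of ℝ^α, let s₀, σ₀ > 0, let c₀, c₁ be continuous real-valued functions on K, and let h₀, h₂ belong to the class I(K) (with h₂ defined on (0,σ₀) × K and h₀ on (0,s₀) × K). Define T₂(σ;a) := c₀(a) + c₁(a)σ + σ h₂(σ;a) for σ ∈ (0,σ₀) and D(s;a) := s·h₀(s;a), and assume 0 < D(s;a) < σ₀ for all s ∈ (0,s₀) and a ∈ K. Then T₂(D(s;a);a) = c₀(a) + s·ĥ₂(s;a), where ĥ₂(s;a) := c₁(a) h₀(s;a) + h₀(s;a) h₂(s h₀(s;a); a), and ĥ₂ belongs to the class I(K). -/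
open Set

/-- A function `h : (0,s₀) × K → ℝ`, differentiable in its first variable, belongs to the
class `I(K)` if `h(s;a) → 0` and `s·∂_s h(s;a) → 0` as `s → 0⁺`, uniformly in `a ∈ K`. -/
def InClassI {α : ℕ} (K : Set (Fin α → ℝ)) (s₀ : ℝ) (h : ℝ → (Fin α → ℝ) → ℝ) : Prop :=
  (∀ a ∈ K, ∀ s : ℝ, 0 < s → s < s₀ → DifferentiableAt ℝ (fun s' => h s' a) s) ∧
  (∀ η > (0 : ℝ), ∃ δ > (0 : ℝ), ∀ s : ℝ, 0 < s → s < δ → s < s₀ → ∀ a ∈ K,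
    |h s a| < η) ∧
  (∀ η > (0 : ℝ), ∃ δ > (0 : ℝ), ∀ s : ℝ, 0 < s → s < δ → s < s₀ → ∀ a ∈ K,
    |s * deriv (fun s' => h s' a) s| < η)

namespace InClassI

variable {α : ℕ} {K : Set (Fin α → ℝ)} {s₀ σ₀ : ℝ} {f g h : ℝ → (Fin α → ℝ) → ℝ}

theorem add (hf : InClassI K s₀ f) (hg : InClassI K s₀ g) :
    InClassI K s₀ (fun s a => f s a + g s a) := by
  obtain ⟨hfd, hf, hf'⟩ := hf
  obtain ⟨hgd, hg, hg'⟩ := hg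
  refine ⟨fun a ha s hs hs₀ => (hfd a ha s hs hs₀).add (hgd a ha s hs hs₀),
    fun η hη => ?_, fun η hη => ?_⟩
  · obtain ⟨δ, hδ, hf⟩ := hf (η / 2) (half_pos hη)
    obtain ⟨ε, hε, hg⟩ := hg (η / 2) (half_pos hη)
    refine ⟨min δ ε, lt_min hδ hε, fun s hs hsδ hs₀ a ha => ?_⟩
    have hfs := hf s hs (hsδ.trans_le (min_le_left _ _)) hs₀ a ha
    have hgs := hg s hs (hsδ.trans_le (min_le_right _ _)) hs₀ a ha
    linarith [abs_add_le (f s a) (g s a)]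
  · obtain ⟨δ, hδ, hf⟩ := hf' (η / 2) (half_pos hη)
    obtain ⟨ε, hε, hg⟩ := hg' (η / 2) (half_pos hη)
    refine ⟨min δ ε, lt_min hδ hε, fun s hs hsδ hs₀ a ha => ?_⟩
    have hfs := hf s hs (hsδ.trans_le (min_le_left _ _)) hs₀ a ha
    have hgs := hg s hs (hsδ.trans_le (min_le_right _ _)) hs₀ a ha
    rw [deriv_fun_add (hfd a ha s hs hs₀) (hgd a ha s hs hs₀), mul_add]
    linarith [abs_add_le (s * deriv (fun s' => f s' a) s) (s * deriv (fun s' => g s' a) s)]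

theorem bounded_mul {c : (Fin α → ℝ) → ℝ} {C : ℝ} (hc : ∀ a ∈ K, |c a| ≤ C)
    (hf : InClassI K s₀ f) : InClassI K s₀ (fun s a => c a * f s a) := by
  obtain ⟨hfd, hf, hf'⟩ := hf
  have hC : 0 < |C| + 1 := by positivity
  have small {a : Fin α → ℝ} (ha : a ∈ K) {x η : ℝ} (hx : |x| < η / (|C| + 1)) :
      |c a * x| < η := by
    rw [lt_div_iff₀ hC] at hx
    have hca : |c a| ≤ |C| + 1 := by linarith [hc a ha, le_abs_self C]
    calc |c a * x| = |c a| * |x| := abs_mul _ _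
      _ ≤ (|C| + 1) * |x| := by gcongr
      _ < η := by linarith
  refine ⟨fun a ha s hs hs₀ => (hfd a ha s hs hs₀).const_mul (c a),
    fun η hη => ?_, fun η hη => ?_⟩
  · obtain ⟨δ, hδ, hf⟩ := hf (η / (|C| + 1)) (by positivity)
    exact ⟨δ, hδ, fun s hs hsδ hs₀ a ha => small ha (hf s hs hsδ hs₀ a ha)⟩
  · obtain ⟨δ, hδ, hf⟩ := hf' (η / (|C| + 1)) (by positivity)
    refine ⟨δ, hδ, fun s hs hsδ hs₀ a ha => ?_⟩
    rw [deriv_const_mul _ (hfd a ha s hs hs₀), mul_left_comm]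
    exact small ha (hf s hs hsδ hs₀ a ha)

/-- Although `g (s * h s a) a` need not itself be of class `I(K)`, its product with `h` is. -/
theorem mul_comp (hh : InClassI K s₀ h) (hg : InClassI K σ₀ g)
    (hrange : ∀ a ∈ K, ∀ s : ℝ, 0 < s → s < s₀ → 0 < s * h s a ∧ s * h s a < σ₀) :
    InClassI K s₀ (fun s a => h s a * g (s * h s a) a) := by
  obtain ⟨hhd, hh, hh'⟩ := hh
  obtain ⟨hgd, hg, hg'⟩ := hg
  have hasDeriv (a) (ha : a ∈ K) (s : ℝ) (hs : 0 < s) (hs₀ : s < s₀) :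
      HasDerivAt (fun s' => h s' a * g (s' * h s' a) a)
        (deriv (fun s' => h s' a) s * g (s * h s a) a +
          h s a * (deriv (fun σ => g σ a) (s * h s a) *
            (1 * h s a + s * deriv (fun s' => h s' a) s))) s := by
    have hr := hrange a ha s hs hs₀
    have h₁ := (hhd a ha s hs hs₀).hasDerivAt
    have h₂ := (hgd a ha _ hr.1 hr.2).hasDerivAt
    have h₃ : HasDerivAt (fun s' => s' * h s' a)
        (1 * h s a + s * deriv (fun s' => h s' a) s) s := (hasDerivAt_id s).mul h₁
    exact h₁.mul (HasDerivAt.comp (h₂ := fun σ => g σ a) s h₂ h₃)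
  have comp_lt {s ε : ℝ} {a : Fin α → ℝ} (hs : 0 < s) (hsε : s < ε) (hha : |h s a| < 1) :
      s * h s a < ε := by
    nlinarith [le_abs_self (h s a)]
  refine ⟨fun a ha s hs hs₀ => (hasDeriv a ha s hs hs₀).differentiableAt,
    fun η hη => ?_, fun η hη => ?_⟩
  · obtain ⟨δ, hδ, hh⟩ := hh (min 1 η) (lt_min one_pos hη)
    obtain ⟨ε, hε, hg⟩ := hg 1 one_pos
    refine ⟨min δ ε, lt_min hδ hε, fun s hs hsδ hs₀ a ha => ?_⟩
    obtain ⟨hsδ, hsε⟩ := lt_min_iff.1 hsδ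
    obtain ⟨hh1, hhη⟩ := lt_min_iff.1 (hh s hs hsδ hs₀ a ha)
    have hr := hrange a ha s hs hs₀
    have hgs := hg _ hr.1 (comp_lt hs hsε hh1) hr.2 a ha
    rw [abs_mul]
    exact (mul_le_of_le_one_right (abs_nonneg _) hgs.le).trans_lt hhη
  · obtain ⟨δ, hδ, hh⟩ := hh (min 1 (η / 3)) (lt_min one_pos (by positivity))
    obtain ⟨δ', hδ', hh'⟩ := hh' (η / 3) (by positivity)
    obtain ⟨ε, hε, hg⟩ := hg 1 one_pos
    obtain ⟨ε', hε', hg'⟩ := hg' 1 one_pos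
    refine ⟨min (min δ δ') (min ε ε'), lt_min (lt_min hδ hδ') (lt_min hε hε'),
      fun s hs hsδ hs₀ a ha => ?_⟩
    simp only [lt_min_iff] at hsδ
    obtain ⟨⟨hsδ, hsδ'⟩, hsε, hsε'⟩ := hsδ
    obtain ⟨hh1, hhη⟩ := lt_min_iff.1 (hh s hs hsδ hs₀ a ha)
    have hhs' := hh' s hs hsδ' hs₀ a ha
    have hr := hrange a ha s hs hs₀
    have hgs := hg _ hr.1 (comp_lt hs hsε hh1) hr.2 a ha
    have hgs' := hg' _ hr.1 (comp_lt hs hsε' hh1) hr.2 a ha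
    rw [(hasDeriv a ha s hs hs₀).deriv]
    set p := s * deriv (fun s' => h s' a) s with hp
    set r := s * h s a * deriv (fun σ => g σ a) (s * h s a) with hr'
    calc |s * (deriv (fun s' => h s' a) s * g (s * h s a) a +
            h s a * (deriv (fun σ => g σ a) (s * h s a) * (1 * h s a + p)))|
        = |p * g (s * h s a) a + r * (h s a + p)| := by
          congr 1
          rw [hr', hp]
          ring
      _ ≤ |p| * |g (s * h s a) a| + |r| * (|h s a| + |p|) := by
          refine (abs_add_le _ _).trans ?_
          rw [abs_mul p, abs_mul r]
          gcongr
          exact abs_add_le _ _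
      _ ≤ |p| * 1 + 1 * (|h s a| + |p|) := by gcongr
      _ < η := by linarith

end InClassI

/-- Composition of the transition time `T₂(σ;a) = c₀(a) + c₁(a)σ + σ h₂(σ;a)` with the
Dulac map `D(s;a) = s h₀(s;a)`: one gets `T₂(D(s;a);a) = c₀(a) + s ĥ₂(s;a)` where
`ĥ₂ = c₁ h₀ + h₀ · h₂∘D` belongs to the class `I(K)`. -/
theorem transition_time_comp_dulac_map
    {α : ℕ} (K : Set (Fin α → ℝ)) (hK : IsCompact K)
    (s₀ σ₀ : ℝ) (hs₀ : 0 < s₀) (hσ₀ : 0 < σ₀)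
    (c₀ c₁ : (Fin α → ℝ) → ℝ)
    (hc₀ : ContinuousOn c₀ K) (hc₁ : ContinuousOn c₁ K)
    (h₀ h₂ : ℝ → (Fin α → ℝ) → ℝ)
    (hh₀ : InClassI K s₀ h₀) (hh₂ : InClassI K σ₀ h₂)
    (T₂ : ℝ → (Fin α → ℝ) → ℝ)
    (hT₂ : ∀ (σ : ℝ) (a : Fin α → ℝ), T₂ σ a = c₀ a + c₁ a * σ + σ * h₂ σ a)
    (D : ℝ → (Fin α → ℝ) → ℝ)
    (hD : ∀ (s : ℝ) (a : Fin α → ℝ), D s a = s * h₀ s a)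
    (hDrange : ∀ a ∈ K, ∀ s : ℝ, 0 < s → s < s₀ → 0 < D s a ∧ D s a < σ₀) :
    (∀ a ∈ K, ∀ s : ℝ, 0 < s → s < s₀ →
      T₂ (D s a) a = c₀ a + s * (c₁ a * h₀ s a + h₀ s a * h₂ (s * h₀ s a) a)) ∧
    InClassI K s₀ (fun s a => c₁ a * h₀ s a + h₀ s a * h₂ (s * h₀ s a) a) := by
  simp only [hD] at hDrange ⊢
  obtain ⟨C, hC⟩ := hK.exists_bound_of_continuousOn hc₁
  refine ⟨fun a _ s _ _ => ?_, (hh₀.bounded_mul hC).add (hh₀.mul_comp hh₂ hDrange)⟩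
  rw [hT₂]
  ring
end

section
/- Let F ∈ ℝ with F ≠ 0, and consider the planar vector field Y(x,y) = ( x(x² + 2F), y(x² + 2F - 2) ) on the open set Ω = { (x,y) ∈ ℝ² : x > 0 and x² + 2F > 0 }. Then the function I(x,y) := (y/x) (1 + 2F/x²)^{-1/(2F)} is a first integral of Y on Ω; that is, x(x² + 2F) ∂_x I(x,y) + y(x² + 2F - 2) ∂_y I(x,y) = 0 for all (x,y) ∈ Ω. -/
/-- For `F ≠ 0`, the function `I(x,y) = (y/x)(1 + 2F/x²)^{-1/(2F)}` is a first integral of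
the vector field `Y(x,y) = (x(x²+2F), y(x²+2F-2))` on `{x > 0, x²+2F > 0}`:
`x(x²+2F) ∂_x I + y(x²+2F-2) ∂_y I = 0`. -/
theorem first_integral_normal_form (F : ℝ) (hF : F ≠ 0) :
    let I : ℝ → ℝ → ℝ := fun x y => (y / x) * (1 + 2 * F / x ^ 2) ^ (-(1 / (2 * F)))
    ∀ x y : ℝ, 0 < x → 0 < x ^ 2 + 2 * F →
      x * (x ^ 2 + 2 * F) * deriv (fun x' => I x' y) x
        + y * (x ^ 2 + 2 * F - 2) * deriv (fun y' => I x y') y = 0 := by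
  intro I x y hx hΩ
  have hx0 : x ≠ 0 := hx.ne'
  have hs : x ^ 2 + 2 * F ≠ 0 := hΩ.ne'
  have hu : 1 + 2 * F / x ^ 2 = (x ^ 2 + 2 * F) / x ^ 2 := by field_simp
  have hu0 : 0 < 1 + 2 * F / x ^ 2 := by rw [hu]; positivity
  have hbase : HasDerivAt (fun x' : ℝ => 1 + 2 * F / x' ^ 2) (-(4 * F) / x ^ 3) x := by
    refine (((hasDerivAt_const x (2 * F)).div (hasDerivAt_pow 2 x)
      (pow_ne_zero 2 hx0)).const_add 1).congr_deriv ?_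
    field_simp
    norm_num
    ring
  have hdx : HasDerivAt (fun x' => I x' y) _ x :=
    ((hasDerivAt_const x y).div (hasDerivAt_id x) hx0).mul
      (hbase.rpow_const (p := -(1 / (2 * F))) (Or.inl hu0.ne'))
  have hdy : HasDerivAt (fun y' => I x y') _ y :=
    ((hasDerivAt_id y).div_const x).mul_const ((1 + 2 * F / x ^ 2) ^ (-(1 / (2 * F))))
  rw [hdx.deriv, hdy.deriv, Real.rpow_sub_one hu0.ne']
  generalize (1 + 2 * F / x ^ 2) ^ (-(1 / (2 * F))) = P
  simp only [Pi.div_apply, id_eq]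
  rw [hu]
  field_simp
  ring
end

section
/- Let D ∈ (-1,0) and F ∈ (-1/2,1/2) with F ≠ 0, and define g(z,w) := D w² / (2(F-1)(D+1)) - (2D+1) z w / ((2F-1)(D+1)) + 1/(2(D+1)). Consider the planar vector field Z̄(z,w) = ( z( F + (D+1)z² - (2D+1)zw + D w² ), w( -1 + F + (D+1)z² - (2D+1)zw + D w² ) ) on the open set Ω = { (z,w) : z > 0 and 1 + 2F g(z,w)/z² > 0 }. Then Ī(z,w) := (w/z) ( 1 + 2F g(z,w)/z² )^{-1/(2F)} is a first integral of Z̄ on Ω; that is, the directional derivative of Ī along Z̄ vanishes identically on Ω. -/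
/-- If the derivative of `h` along the vector `(z q, w (q - 1))` at `(z, w)` is `-2F h`, then the
derivative of `(w / z) h ^ (-(1 / (2F)))` along that vector vanishes. -/
theorem directional_deriv_ratio_mul_rpow_eq_zero {F : ℝ} (hF0 : F ≠ 0) {h : ℝ → ℝ → ℝ}
    {z w q hz hw : ℝ} (hz0 : z ≠ 0) (hpos : 0 < h z w)
    (dz : HasDerivAt (fun z' => h z' w) hz z) (dw : HasDerivAt (fun w' => h z w') hw w)
    (hZ : z * q * hz + w * (q - 1) * hw = -(2 * F) * h z w) :
    z * q * deriv (fun z' => (w / z') * h z' w ^ (-(1 / (2 * F)))) z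
      + w * (q - 1) * deriv (fun w' => (w' / z) * h z w' ^ (-(1 / (2 * F)))) w = 0 := by
  have ez := ((hasDerivAt_const z w).div (hasDerivAt_id z) hz0).mul
    (dz.rpow_const (p := -(1 / (2 * F))) (Or.inl hpos.ne'))
  have ew := ((hasDerivAt_id w).div_const z).mul
    (dw.rpow_const (p := -(1 / (2 * F))) (Or.inl hpos.ne'))
  have hpow : h z w ^ (-(1 / (2 * F))) = h z w ^ (-(1 / (2 * F)) - 1) * h z w := by
    rw [← Real.rpow_add_one hpos.ne', sub_add_cancel]
  have ez' : deriv (fun z' => (w / z') * h z' w ^ (-(1 / (2 * F)))) z = _ := ez.deriv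
  have ew' : deriv (fun w' => (w' / z) * h z w' ^ (-(1 / (2 * F)))) w = _ := ew.deriv
  rw [ez', ew']
  simp only [id, Pi.div_apply, hpow]
  generalize h z w ^ (-(1 / (2 * F)) - 1) = r
  field_simp
  linear_combination (-r * w) * hZ

/-- For `D ∈ (-1,0)`, `F ∈ (-1/2,1/2)`, `F ≠ 0`, the function
`Ī(z,w) = (w/z)(1 + 2F g(z,w)/z²)^{-1/(2F)}` is a first integral on
`{z > 0, 1 + 2F g/z² > 0}` of the vector field
`Z̄(z,w) = (z(F+(D+1)z²-(2D+1)zw+Dw²), w(-1+F+(D+1)z²-(2D+1)zw+Dw²))`. -/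
theorem first_integral_projective_chart
    (D F : ℝ) (hD : D ∈ Set.Ioo (-1 : ℝ) 0)
    (hF : F ∈ Set.Ioo (-(1 / 2) : ℝ) (1 / 2)) (hF0 : F ≠ 0) :
    let g : ℝ → ℝ → ℝ := fun z w =>
      D * w ^ 2 / (2 * (F - 1) * (D + 1)) - (2 * D + 1) * z * w / ((2 * F - 1) * (D + 1))
        + 1 / (2 * (D + 1))
    let Ibar : ℝ → ℝ → ℝ := fun z w =>
      (w / z) * (1 + 2 * F * g z w / z ^ 2) ^ (-(1 / (2 * F)))
    ∀ z w : ℝ, 0 < z → 0 < 1 + 2 * F * g z w / z ^ 2 →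
      z * (F + (D + 1) * z ^ 2 - (2 * D + 1) * z * w + D * w ^ 2)
          * deriv (fun z' => Ibar z' w) z
        + w * (-1 + F + (D + 1) * z ^ 2 - (2 * D + 1) * z * w + D * w ^ 2)
          * deriv (fun w' => Ibar z w') w = 0 := by
  intro g Ibar z w hz hpos
  have hD1 : D + 1 ≠ 0 := by linarith [hD.1]
  have hF1 : F - 1 ≠ 0 := by linarith [hF.2]
  have hF2 : 2 * F - 1 ≠ 0 := by linarith [hF.2]
  have hF2' : F * 2 - 1 ≠ 0 := by rwa [mul_comm]
  have hz0 : z ≠ 0 := hz.ne'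
  have gz : HasDerivAt (fun z' => g z' w) (-((2 * D + 1) * w / ((2 * F - 1) * (D + 1)))) z := by
    have := ((((hasDerivAt_id z).const_mul (2 * D + 1)).mul_const w).div_const
      ((2 * F - 1) * (D + 1))).const_sub (D * w ^ 2 / (2 * (F - 1) * (D + 1)))
    simpa [g] using this.add_const (1 / (2 * (D + 1)))
  have gw : HasDerivAt (fun w' => g z w')
      (D * (2 * w) / (2 * (F - 1) * (D + 1)) - (2 * D + 1) * z / ((2 * F - 1) * (D + 1))) w := by
    have := ((((hasDerivAt_id w).pow 2).const_mul D).div_const (2 * (F - 1) * (D + 1))).sub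
      (((hasDerivAt_id w).const_mul ((2 * D + 1) * z)).div_const ((2 * F - 1) * (D + 1)))
    simpa [g] using this.add_const (1 / (2 * (D + 1)))
  have dz := ((gz.const_mul (2 * F)).div (hasDerivAt_pow 2 z) (pow_ne_zero 2 hz0)).const_add 1
  have dw := ((gw.const_mul (2 * F)).div_const (z ^ 2)).const_add 1
  have key := directional_deriv_ratio_mul_rpow_eq_zero hF0
    (h := fun z w => 1 + 2 * F * g z w / z ^ 2)
    (q := F + (D + 1) * z ^ 2 - (2 * D + 1) * z * w + D * w ^ 2) hz0 hpos dz dw (by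
      simp only [g]
      push_cast
      field_simp
      ring)
  linear_combination key
end

section
/- Let D ∈ (-1,0) and F ∈ (-1/2,1/2) with F ≠ 1, and define g(z,w) := D w² / (2(F-1)(D+1)) - (2D+1) z w / ((2F-1)(D+1)) + 1/(2(D+1)), Ψ(z,w) := ( z/√(g(z,w)), w/√(g(z,w)) ), U(x,y) := ( (2D+1)xy/(2(2F-1)) - D y²/(4(F-1)) + (D+1)/2 )^{-1/2}, and the vector fields X̄(z,w) := (1/z)( z( F + (D+1)z² - (2D+1)zw + D w² ), w( -1 + F + (D+1)z² - (2D+1)zw + D w² ) ) and X(x,y) := (1/(x U(x,y))) ( x(x² + 2F), y(x² + 2F - 2) ). Then on a neighborhood of (z,w) = (0,0) intersected with {z ≠ 0} (where g > 0 and the expressions are defined), Ψ conjugates X̄ to X: DΨ(z,w) · X̄(z,w) = X(Ψ(z,w)). -/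
/-- The derivative of `f / √G` for a continuous linear functional `f`. -/
lemma ContinuousLinearMap.exists_hasFDerivAt_div_sqrt {E : Type*} [NormedAddCommGroup E]
    [NormedSpace ℝ E] (f : E →L[ℝ] ℝ) {G : E → ℝ} {G' : E →L[ℝ] ℝ} {p : E}
    (hG : HasFDerivAt G G' p) (hp : 0 < G p) :
    ∃ L : E →L[ℝ] ℝ, HasFDerivAt (fun q => f q / Real.sqrt (G q)) L p ∧
      ∀ v, L v = (f v - f p * G' v / (2 * G p)) / Real.sqrt (G p) := by
  have hs : 0 < Real.sqrt (G p) := Real.sqrt_pos.2 hp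
  have h2 : G p = Real.sqrt (G p) ^ 2 := (Real.sq_sqrt hp.le).symm
  have hinv := (hasDerivAt_inv hs.ne').comp_hasFDerivAt p (HasFDerivAt.sqrt hG hp.ne')
  refine ⟨_, HasFDerivAt.mul f.hasFDerivAt hinv, fun v => ?_⟩
  simp only [smul_apply, add_apply, smul_eq_mul]
  rw [h2, Real.sqrt_sq hs.le]
  field_simp
  ring

/-- The derivative of a quadratic polynomial `a w² - b z w + c` on the plane. -/
lemma exists_hasFDerivAt_quadratic (a b c : ℝ) (p : ℝ × ℝ) :
    ∃ L : ℝ × ℝ →L[ℝ] ℝ,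
      HasFDerivAt (fun q : ℝ × ℝ => a * q.2 ^ 2 - b * (q.1 * q.2) + c) L p ∧
      ∀ v, L v = 2 * a * p.2 * v.2 - b * (p.1 * v.2 + p.2 * v.1) := by
  have h1 : HasFDerivAt (fun q : ℝ × ℝ => q.1) (ContinuousLinearMap.fst ℝ ℝ ℝ) p := hasFDerivAt_fst
  have h2 : HasFDerivAt (fun q : ℝ × ℝ => q.2) (ContinuousLinearMap.snd ℝ ℝ ℝ) p := hasFDerivAt_snd
  refine ⟨_, ((HasFDerivAt.const_mul (HasFDerivAt.pow h2 2) a).fun_sub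
    (HasFDerivAt.const_mul (HasFDerivAt.fun_mul h1 h2) b)).add_const c,
    fun v => ?_⟩
  simp
  ring

/-- The change of coordinates `Ψ(z,w) = (z/√g(z,w), w/√g(z,w))` conjugates, near the
origin and away from `{z = 0}`, the projectivized Loud vector field `X̄` to the normal
form `X(x,y) = (1/(x U(x,y))) (x(x²+2F), y(x²+2F-2))`: `DΨ(z,w)·X̄(z,w) = X(Ψ(z,w))`. -/
theorem psi_conjugates_Xbar_to_normal_form
    (D F : ℝ) (hD : D ∈ Set.Ioo (-1 : ℝ) 0)
    (hF : F ∈ Set.Ioo (-(1 / 2) : ℝ) (1 / 2)) (hF1 : F ≠ 1) :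
    let g : ℝ → ℝ → ℝ := fun z w =>
      D * w ^ 2 / (2 * (F - 1) * (D + 1)) - (2 * D + 1) * z * w / ((2 * F - 1) * (D + 1))
        + 1 / (2 * (D + 1))
    let Ψ : ℝ × ℝ → ℝ × ℝ := fun p =>
      (p.1 / Real.sqrt (g p.1 p.2), p.2 / Real.sqrt (g p.1 p.2))
    let U : ℝ → ℝ → ℝ := fun x y =>
      ((2 * D + 1) * x * y / (2 * (2 * F - 1)) - D * y ^ 2 / (4 * (F - 1))
        + (D + 1) / 2) ^ (-(1 / 2) : ℝ)
    let Xbar : ℝ × ℝ → ℝ × ℝ := fun p =>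
      ((1 / p.1) * (p.1 * (F + (D + 1) * p.1 ^ 2 - (2 * D + 1) * p.1 * p.2 + D * p.2 ^ 2)),
       (1 / p.1) * (p.2 * (-1 + F + (D + 1) * p.1 ^ 2 - (2 * D + 1) * p.1 * p.2 + D * p.2 ^ 2)))
    let X : ℝ × ℝ → ℝ × ℝ := fun q =>
      ((1 / (q.1 * U q.1 q.2)) * (q.1 * (q.1 ^ 2 + 2 * F)),
       (1 / (q.1 * U q.1 q.2)) * (q.2 * (q.1 ^ 2 + 2 * F - 2)))
    ∃ r > (0 : ℝ), ∀ p : ℝ × ℝ, p.1 ≠ 0 → ‖p‖ < r → 0 < g p.1 p.2 →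
      ∃ L : ℝ × ℝ →L[ℝ] ℝ × ℝ, HasFDerivAt Ψ L p ∧ L (Xbar p) = X (Ψ p) := by
  intro g Ψ U Xbar X
  refine ⟨1, one_pos, ?_⟩
  rintro ⟨z, w⟩ hz - hg
  simp only at hz hg
  have hD1 : D + 1 ≠ 0 := by linarith [hD.1]
  have hF2 : 2 * F - 1 ≠ 0 := by linarith [hF.2]
  have hF3 : F - 1 ≠ 0 := sub_ne_zero.2 hF1
  obtain ⟨G', hG', hG'v⟩ := exists_hasFDerivAt_quadratic (D / (2 * (F - 1) * (D + 1)))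
    ((2 * D + 1) / ((2 * F - 1) * (D + 1))) (1 / (2 * (D + 1))) (z, w)
  have hG : HasFDerivAt (fun q : ℝ × ℝ => g q.1 q.2) G' (z, w) := by
    convert hG' using 2 with q
    simp only [g]
    ring
  obtain ⟨L₁, hL₁, hL₁v⟩ :=
    (ContinuousLinearMap.fst ℝ ℝ ℝ).exists_hasFDerivAt_div_sqrt hG hg
  obtain ⟨L₂, hL₂, hL₂v⟩ :=
    (ContinuousLinearMap.snd ℝ ℝ ℝ).exists_hasFDerivAt_div_sqrt hG hg
  refine ⟨L₁.prod L₂, hL₁.prodMk hL₂, ?_⟩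
  have hs : 0 < Real.sqrt (g z w) := Real.sqrt_pos.2 hg
  have hsq : Real.sqrt (g z w) ^ 2 = g z w := Real.sq_sqrt hg.le
  have hgdot : G' (Xbar (z, w)) =
      (2 * ((D + 1) * z ^ 2 - (2 * D + 1) * z * w + D * w ^ 2) * g z w - z ^ 2) / z := by
    rw [hG'v]
    simp only [Xbar, g]
    field_simp
    ring
  have hU : U (z / Real.sqrt (g z w)) (w / Real.sqrt (g z w)) = 2 * Real.sqrt (g z w) := by
    have hbase : (2 * D + 1) * (z / Real.sqrt (g z w)) * (w / Real.sqrt (g z w))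
          / (2 * (2 * F - 1)) - D * (w / Real.sqrt (g z w)) ^ 2 / (4 * (F - 1)) + (D + 1) / 2
        = (2 * Real.sqrt (g z w)) ^ (-2 : ℝ) := by
      rw [Real.rpow_neg (by positivity), Real.rpow_two, mul_pow, hsq]
      have hquad : (2 * D + 1) * (z * w) / (2 * (2 * F - 1)) - D * w ^ 2 / (4 * (F - 1))
          + (D + 1) / 2 * g z w = 1 / 4 := by
        simp only [g]
        field_simp
        ring
      calc _ = ((2 * D + 1) * (z * w) / (2 * (2 * F - 1)) - D * w ^ 2 / (4 * (F - 1))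
            + (D + 1) / 2 * Real.sqrt (g z w) ^ 2) / Real.sqrt (g z w) ^ 2 := by
              field_simp
        _ = _ := by
              rw [hsq, hquad]
              field_simp
              norm_num
    simp only [U]
    rw [hbase, ← Real.rpow_mul (by positivity)]
    norm_num
  have hX : X (Ψ (z, w)) =
      (((z ^ 2 / g z w + 2 * F) / (2 * z)) * (z / Real.sqrt (g z w)),
       ((z ^ 2 / g z w + 2 * F - 2) / (2 * z)) * (w / Real.sqrt (g z w))) := by
    simp only [X, Ψ, hU, div_pow, hsq]
    ext <;> field_simp
  rw [hX]
  ext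
  · simp only [ContinuousLinearMap.prod_apply, hL₁v, hgdot, ContinuousLinearMap.coe_fst']
    simp only [Xbar]
    field_simp
    ring
  · simp only [ContinuousLinearMap.prod_apply, hL₂v, hgdot, ContinuousLinearMap.coe_snd']
    simp only [Xbar]
    field_simp
    ring
end

section
/- Let D, F ∈ ℝ and consider the dehomogenized Loud vector field L(u,v) = ( -v + uv, u + Du² + Fv² ) on ℝ², and the map φ(u,v) := ( 1/v, (1-u)/v ), defined for v ≠ 0. Then the pushforward of -L by φ equals the vector field X̄(z,w) := (1/z)( z( F + (D+1)z² - (2D+1)zw + D w² ), w( -1 + F + (D+1)z² - (2D+1)zw + D w² ) ); that is, for all (u,v) with v ≠ 0 and u ≠ 1, Dφ(u,v) · ( -L(u,v) ) = X̄( φ(u,v) ). -/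
/-- The map `φ(u,v) = (1/v, (1-u)/v)` pushes forward the time-reversed dehomogenized Loud
vector field `-L` to the vector field
`X̄(z,w) = (1/z)(z(F+(D+1)z²-(2D+1)zw+Dw²), w(-1+F+(D+1)z²-(2D+1)zw+Dw²))`:
for all `(u,v)` with `v ≠ 0` and `u ≠ 1`, `Dφ(u,v)·(-L(u,v)) = X̄(φ(u,v))`. -/
theorem pushforward_neg_loud_eq_Xbar (D F : ℝ) :
    let L : ℝ × ℝ → ℝ × ℝ := fun p =>
      (-p.2 + p.1 * p.2, p.1 + D * p.1 ^ 2 + F * p.2 ^ 2)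
    let φ : ℝ × ℝ → ℝ × ℝ := fun p => (1 / p.2, (1 - p.1) / p.2)
    let Xbar : ℝ × ℝ → ℝ × ℝ := fun q =>
      ((1 / q.1) * (q.1 * (F + (D + 1) * q.1 ^ 2 - (2 * D + 1) * q.1 * q.2 + D * q.2 ^ 2)),
       (1 / q.1) * (q.2 * (-1 + F + (D + 1) * q.1 ^ 2 - (2 * D + 1) * q.1 * q.2 + D * q.2 ^ 2)))
    ∀ p : ℝ × ℝ, p.2 ≠ 0 → p.1 ≠ 1 →
      ∃ Dφ : ℝ × ℝ →L[ℝ] ℝ × ℝ, HasFDerivAt φ Dφ p ∧ Dφ (-(L p)) = Xbar (φ p) := by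
  intro L φ Xbar p hv _
  have hfst : HasFDerivAt (fun q : ℝ × ℝ => 1 - q.1) (-ContinuousLinearMap.fst ℝ ℝ ℝ) p :=
    hasFDerivAt_fst.const_sub 1
  have hinv : HasFDerivAt (fun q : ℝ × ℝ => q.2⁻¹)
      ((-(p.2 ^ 2)⁻¹) • ContinuousLinearMap.snd ℝ ℝ ℝ) p :=
    (hasDerivAt_inv hv).comp_hasFDerivAt p hasFDerivAt_snd
  have hφ : φ = fun q => (q.2⁻¹, (1 - q.1) * q.2⁻¹) := by
    funext q
    simp only [φ, div_eq_mul_inv, one_mul]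
  refine ⟨_, hφ ▸ hinv.prodMk (hfst.mul hinv), ?_⟩
  ext
  · simp [L, φ, Xbar]
    field_simp
    ring
  · simp [L, φ, Xbar]
    field_simp
    ring
end
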